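/- arXiv:2502.14161 — 2 statements merged into one kernel-verified Lean document; each statement's English description precedes it below -/
import Mathlib

section
/- Let H' be a k-labeled graph, let i ≠ j be labels such that H' has no edge joining an i-vertex to a j-vertex, and let H = η_{i,j}(H') be obtained from H' by adding all edges between vertices of label i and vertices of label j. Then for every natural number s and every tuple σ ∈ {0,1,2}^k, the number of sets S ⊆ V(H) with |S| = s and sgn_H(S) defined and equal to σ is equal to the sum, over all σ' ∈ {0,1,2}^k with f_{i,j}(σ') defined and equal to σ, of the number of sets S' ⊆ V(H') with |S'| = s and sgn_{H'}(S') defined and equal to σ'. Here f_{i,j} is the partial function on {0,1,2}^k with f_{i,j}(σ') = σ given by: σ(w) = σ'(w) for all w ∉ {i,j}; (σ(i),σ(j)) = (σ'(i),σ'(j)) if 0 ∈ {σ'(i),σ'(j)}; (σ(i),σ(j)) = (1,1) if σ'(i) = σ'(j) = 2; and f_{i,j}(σ') is undefined otherwise. -/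
open scoped Classical

/-- The degree of `v` in the induced subgraph `G[S]`. -/
noncomputable def degIn {V : Type*} (G : SimpleGraph V) (S : Set V) (v : V) : ℕ :=
  {u | u ∈ S ∧ G.Adj v u}.ncard

/-- `sgn_{H,i}(S) = a`: the partial signature of `S` at label `i` is defined and equals `a`. -/
def sgnAtIs {V : Type*} {k : ℕ} (G : SimpleGraph V) (lab : V → Fin k) (S : Set V)
    (i : Fin k) (a : Fin 3) : Prop :=
  (a = 0 ∧ S ∩ {v | lab v = i} = ∅) ∨
  (a = 1 ∧ (S ∩ {v | lab v = i}).Nonempty ∧ ∀ v ∈ S ∩ {v | lab v = i}, degIn G S v = 1) ∨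
  (a = 2 ∧ ∃ v : V, S ∩ {v' | lab v' = i} = {v} ∧ degIn G S v = 0)

/-- `sgn_H(S)` is defined and equals `σ`. -/
def SgnIs {V : Type*} {k : ℕ} (G : SimpleGraph V) (lab : V → Fin k) (S : Set V)
    (σ : Fin k → Fin 3) : Prop :=
  ∀ i : Fin k, sgnAtIs G lab S i (σ i)

/-- The number of sets `S ⊆ V` with `|S| = s` and `sgn` defined and equal to `σ`. -/
noncomputable def countSgn {V : Type*} {k : ℕ} (G : SimpleGraph V) (lab : V → Fin k)
    (s : ℕ) (σ : Fin k → Fin 3) : ℕ :=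
  {S : Set V | S.ncard = s ∧ SgnIs G lab S σ}.ncard

/-- The partial function `f_{i,j}` is defined at `σ'` with value `σ`. -/
def fRel {k : ℕ} (i j : Fin k) (σ' σ : Fin k → Fin 3) : Prop :=
  (∀ w : Fin k, w ≠ i → w ≠ j → σ w = σ' w) ∧
  (((σ' i = 0 ∨ σ' j = 0) ∧ σ i = σ' i ∧ σ j = σ' j) ∨
   ((σ' i = 2 ∧ σ' j = 2) ∧ σ i = 1 ∧ σ j = 1))

section Signature

variable {V : Type*} {k : ℕ} {G G' : SimpleGraph V} {lab : V → Fin k} {S : Set V}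

theorem sgnAtIs_zero {w : Fin k} :
    sgnAtIs G lab S w 0 ↔ S ∩ {v | lab v = w} = ∅ := by
  simp [sgnAtIs]

theorem sgnAtIs_one {w : Fin k} :
    sgnAtIs G lab S w 1 ↔
      (S ∩ {v | lab v = w}).Nonempty ∧ ∀ v ∈ S ∩ {v | lab v = w}, degIn G S v = 1 := by
  simp [sgnAtIs]

theorem sgnAtIs_two {w : Fin k} :
    sgnAtIs G lab S w 2 ↔ ∃ v : V, S ∩ {v' | lab v' = w} = {v} ∧ degIn G S v = 0 := by
  simp [sgnAtIs]

theorem sgnAtIs_unique {w : Fin k} {a b : Fin 3}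
    (ha : sgnAtIs G lab S w a) (hb : sgnAtIs G lab S w b) : a = b := by
  rcases ha with ⟨rfl, h⟩ | ⟨rfl, h, hd⟩ | ⟨rfl, v, h, hd⟩ <;>
  rcases hb with ⟨rfl, h'⟩ | ⟨rfl, h', hd'⟩ | ⟨rfl, v', h', hd'⟩ <;> try rfl
  all_goals exfalso
  all_goals simp_all

theorem SgnIs_unique {σ τ : Fin k → Fin 3} (hσ : SgnIs G lab S σ) (hτ : SgnIs G lab S τ) :
    σ = τ :=
  funext fun w => sgnAtIs_unique (hσ w) (hτ w)

theorem sgnAtIs_congr {w : Fin k} {a : Fin 3}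
    (h : ∀ v ∈ S, lab v = w → degIn G S v = degIn G' S v) :
    sgnAtIs G lab S w a ↔ sgnAtIs G' lab S w a := by
  have h1 : (∀ v ∈ S ∩ {v | lab v = w}, degIn G S v = 1) ↔
      ∀ v ∈ S ∩ {v | lab v = w}, degIn G' S v = 1 :=
    forall₂_congr fun v hv => by rw [h v hv.1 hv.2]
  have h2 : (∃ v : V, S ∩ {v' | lab v' = w} = {v} ∧ degIn G S v = 0) ↔
      ∃ v : V, S ∩ {v' | lab v' = w} = {v} ∧ degIn G' S v = 0 :=
    exists_congr fun v => and_congr_right fun hv => by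
      have hv' : v ∈ S ∩ {v' | lab v' = w} := hv ▸ rfl
      rw [h v hv'.1 hv'.2]
  rw [sgnAtIs, sgnAtIs, h1, h2]

end Signature

section Join

variable {V : Type*} {k : ℕ} {H' H : SimpleGraph V} {lab : V → Fin k} {i j : Fin k}
  {S : Set V}

theorem degIn_join_eq_of_forall
    (hH : ∀ u v : V, H.Adj u v ↔ H'.Adj u v ∨
      (u ≠ v ∧ ((lab u = i ∧ lab v = j) ∨ (lab u = j ∧ lab v = i))))
    {v : V} (hv : ∀ u ∈ S, ¬ ((lab v = i ∧ lab u = j) ∨ (lab v = j ∧ lab u = i))) :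
    degIn H S v = degIn H' S v := by
  unfold degIn
  congr 1
  ext u
  simp only [Set.mem_ofPred_eq, hH]
  grind

variable [Fintype V]

theorem degIn_eq_zero {G : SimpleGraph V} {v : V} :
    degIn G S v = 0 ↔ ∀ u ∈ S, ¬ G.Adj v u := by
  rw [degIn, Set.ncard_eq_zero (Set.toFinite _), Set.eq_empty_iff_forall_notMem]
  simp

theorem degIn_join_eq_one (hij : i ≠ j)
    (hirred : ∀ u v : V, lab u = i → lab v = j → ¬ H'.Adj u v)
    (hH : ∀ u v : V, H.Adj u v ↔ H'.Adj u v ∨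
      (u ≠ v ∧ ((lab u = i ∧ lab v = j) ∨ (lab u = j ∧ lab v = i))))
    {v w : V} (hv : lab v = i) (hw : w ∈ S) (hwj : lab w = j) :
    degIn H S v = 1 ↔ S ∩ {u | lab u = j} = {w} ∧ degIn H' S v = 0 := by
  have hadj : ∀ u, H.Adj v u ↔ H'.Adj v u ∨ lab u = j := by
    intro u
    rw [hH]
    grind
  rw [degIn_eq_zero, degIn, Set.ncard_eq_one]
  simp only [hadj, Set.ext_iff, Set.mem_inter_iff, Set.mem_ofPred_eq, Set.mem_singleton_iff]
  constructor
  · rintro ⟨x, hx⟩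
    obtain rfl : w = x := (hx w).1 ⟨hw, Or.inr hwj⟩
    refine ⟨fun u => ⟨fun hu => (hx u).1 ⟨hu.1, Or.inr hu.2⟩, ?_⟩, fun u hu hvu => ?_⟩
    · rintro rfl
      exact ⟨hw, hwj⟩
    · obtain rfl := (hx u).1 ⟨hu, Or.inl hvu⟩
      exact hirred v u hv hwj hvu
  · rintro ⟨h1, h2⟩
    refine ⟨w, fun u => ?_⟩
    rw [← h1 u]
    have := h2 u
    tauto

theorem degIn_join_ne_zero (hij : i ≠ j)
    (hH : ∀ u v : V, H.Adj u v ↔ H'.Adj u v ∨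
      (u ≠ v ∧ ((lab u = i ∧ lab v = j) ∨ (lab u = j ∧ lab v = i))))
    {v w : V} (hv : lab v = i) (hw : w ∈ S) (hwj : lab w = j) : degIn H S v ≠ 0 := by
  rw [Ne, degIn_eq_zero]
  intro h
  refine h w hw ((hH v w).2 (Or.inr ⟨?_, Or.inl ⟨hv, hwj⟩⟩))
  rintro rfl
  exact hij (hv.symm.trans hwj)

theorem eq_one_of_sgnAtIs_join (hij : i ≠ j)
    (hH : ∀ u v : V, H.Adj u v ↔ H'.Adj u v ∨
      (u ≠ v ∧ ((lab u = i ∧ lab v = j) ∨ (lab u = j ∧ lab v = i))))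
    {v w : V} (hv : v ∈ S) (hvi : lab v = i) (hw : w ∈ S) (hwj : lab w = j) {a : Fin 3}
    (ha : sgnAtIs H lab S i a) : a = 1 := by
  rcases ha with ⟨-, h⟩ | ⟨rfl, -⟩ | ⟨-, x, h, hd⟩
  · exact absurd (show v ∈ S ∩ {v | lab v = i} from ⟨hv, hvi⟩) (by simp [h])
  · rfl
  · have hx : x ∈ S ∩ {v | lab v = i} := h ▸ rfl
    exact absurd hd (degIn_join_ne_zero hij hH hx.2 hw hwj)

theorem sgnAtIs_join_iff (hij : i ≠ j)
    (hirred : ∀ u v : V, lab u = i → lab v = j → ¬ H'.Adj u v)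
    (hH : ∀ u v : V, H.Adj u v ↔ H'.Adj u v ∨
      (u ≠ v ∧ ((lab u = i ∧ lab v = j) ∨ (lab u = j ∧ lab v = i))))
    {v w : V} (hv : v ∈ S) (hvi : lab v = i) (hw : w ∈ S) (hwj : lab w = j) {a b : Fin 3} :
    sgnAtIs H lab S i a ∧ sgnAtIs H lab S j b ↔
      (a = 1 ∧ b = 1) ∧ sgnAtIs H' lab S i 2 ∧ sgnAtIs H' lab S j 2 := by
  have hirred' : ∀ u v : V, lab u = j → lab v = i → ¬ H'.Adj u v :=
    fun u v hu hv h => hirred v u hv hu h.symm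
  have hH' : ∀ u v : V, H.Adj u v ↔ H'.Adj u v ∨
      (u ≠ v ∧ ((lab u = j ∧ lab v = i) ∨ (lab u = i ∧ lab v = j))) := by
    intro u v
    rw [hH u v, or_comm (a := lab u = i ∧ lab v = j)]
  have hvm : v ∈ S ∩ {v | lab v = i} := ⟨hv, hvi⟩
  have hwm : w ∈ S ∩ {v | lab v = j} := ⟨hw, hwj⟩
  constructor
  · rintro ⟨ha, hb⟩
    obtain rfl := eq_one_of_sgnAtIs_join hij hH hv hvi hw hwj ha
    obtain rfl := eq_one_of_sgnAtIs_join hij.symm hH' hw hwj hv hvi hb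
    rw [sgnAtIs_one] at ha hb
    obtain ⟨hSj, hdv⟩ := (degIn_join_eq_one hij hirred hH hvi hw hwj).1 (ha.2 v hvm)
    obtain ⟨hSi, hdw⟩ := (degIn_join_eq_one hij.symm hirred' hH' hwj hv hvi).1 (hb.2 w hwm)
    exact ⟨⟨rfl, rfl⟩, sgnAtIs_two.2 ⟨v, hSi, hdv⟩, sgnAtIs_two.2 ⟨w, hSj, hdw⟩⟩
  · rintro ⟨⟨rfl, rfl⟩, ha, hb⟩
    obtain ⟨x, hSi, hdx⟩ := sgnAtIs_two.1 ha
    obtain ⟨y, hSj, hdy⟩ := sgnAtIs_two.1 hb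
    obtain rfl : v = x := by rwa [hSi] at hvm
    obtain rfl : w = y := by rwa [hSj] at hwm
    rw [sgnAtIs_one, sgnAtIs_one, hSi, hSj]
    refine ⟨⟨Set.singleton_nonempty v, ?_⟩, ⟨Set.singleton_nonempty w, ?_⟩⟩
    · rintro _ rfl
      exact (degIn_join_eq_one hij hirred hH hvi hw hwj).2 ⟨hSj, hdx⟩
    · rintro _ rfl
      exact (degIn_join_eq_one hij.symm hirred' hH' hwj hv hvi).2 ⟨hSi, hdy⟩

theorem SgnIs_join_iff (hij : i ≠ j)
    (hirred : ∀ u v : V, lab u = i → lab v = j → ¬ H'.Adj u v)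
    (hH : ∀ u v : V, H.Adj u v ↔ H'.Adj u v ∨
      (u ≠ v ∧ ((lab u = i ∧ lab v = j) ∨ (lab u = j ∧ lab v = i))))
    {σ : Fin k → Fin 3} :
    SgnIs H lab S σ ↔ ∃ σ', fRel i j σ' σ ∧ SgnIs H' lab S σ' := by
  by_cases hboth : (∃ v ∈ S, lab v = i) ∧ ∃ w ∈ S, lab w = j
  · obtain ⟨⟨v, hv, hvi⟩, w, hw, hwj⟩ := hboth
    have hother : ∀ l, l ≠ i → l ≠ j → ∀ a,
        (sgnAtIs H lab S l a ↔ sgnAtIs H' lab S l a) := by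
      rintro l hli hlj a
      refine sgnAtIs_congr fun u _ hul => degIn_join_eq_of_forall hH fun x _ => ?_
      rintro (⟨h, -⟩ | ⟨h, -⟩)
      · exact hli (hul.symm.trans h)
      · exact hlj (hul.symm.trans h)
    constructor
    · intro h
      obtain ⟨⟨hi, hj⟩, hi', hj'⟩ :=
        (sgnAtIs_join_iff hij hirred hH hv hvi hw hwj).1 ⟨h i, h j⟩
      refine ⟨fun l => if l = i ∨ l = j then 2 else σ l,
        ⟨fun l hli hlj => by simp [hli, hlj], Or.inr (by simp [hi, hj])⟩, fun l => ?_⟩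
      by_cases hli : l = i
      · subst hli
        simpa using hi'
      by_cases hlj : l = j
      · subst hlj
        simpa using hj'
      · simpa [hli, hlj] using (hother l hli hlj _).1 (h l)
    · rintro ⟨σ', ⟨heq, ⟨h0, -⟩ | ⟨⟨h2i, h2j⟩, h1i, h1j⟩⟩, h⟩
      · exfalso
        have hi := h i
        have hj := h j
        rcases h0 with h0 | h0
        · rw [h0, sgnAtIs_zero] at hi
          exact Set.eq_empty_iff_forall_notMem.1 hi v ⟨hv, hvi⟩
        · rw [h0, sgnAtIs_zero] at hj
          exact Set.eq_empty_iff_forall_notMem.1 hj w ⟨hw, hwj⟩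
      · obtain ⟨hi, hj⟩ := (sgnAtIs_join_iff hij hirred hH hv hvi hw hwj).2
          ⟨⟨h1i, h1j⟩, h2i ▸ h i, h2j ▸ h j⟩
        intro l
        by_cases hli : l = i
        · exact hli ▸ hi
        by_cases hlj : l = j
        · exact hlj ▸ hj
        · rw [hother l hli hlj, heq l hli hlj]
          exact h l
  · have hiff : ∀ τ, SgnIs H lab S τ ↔ SgnIs H' lab S τ := fun τ =>
      forall_congr' fun l => sgnAtIs_congr fun u hu _ =>
        degIn_join_eq_of_forall hH fun x hx => by
          rintro (⟨h1, h2⟩ | ⟨h1, h2⟩)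
          · exact hboth ⟨⟨u, hu, h1⟩, x, hx, h2⟩
          · exact hboth ⟨⟨x, hx, h2⟩, u, hu, h1⟩
    have hempty : S ∩ {v | lab v = i} = ∅ ∨ S ∩ {v | lab v = j} = ∅ := by
      rw [not_and_or] at hboth
      simpa [Set.eq_empty_iff_forall_notMem] using hboth
    have hzero : ∀ τ, SgnIs H' lab S τ → τ i = 0 ∨ τ j = 0 := fun τ hτ =>
      hempty.imp (fun h => sgnAtIs_unique (hτ i) (sgnAtIs_zero.2 h))
        (fun h => sgnAtIs_unique (hτ j) (sgnAtIs_zero.2 h))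
    rw [hiff]
    constructor
    · exact fun h => ⟨σ, ⟨fun _ _ _ => rfl, Or.inl ⟨hzero σ h, rfl, rfl⟩⟩, h⟩
    · rintro ⟨σ', ⟨heq, hcase⟩, h⟩
      have h0 := hzero σ' h
      obtain ⟨hi, hj⟩ : σ i = σ' i ∧ σ j = σ' j := by
        rcases hcase with ⟨-, h'⟩ | ⟨⟨hi, hj⟩, -⟩
        · exact h'
        · simp [hi, hj] at h0
      obtain rfl : σ = σ' := by
        funext l
        by_cases hli : l = i
        · exact hli ▸ hi
        by_cases hlj : l = j
        · exact hlj ▸ hj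
        · exact heq l hli hlj
      exact h

end Join

theorem countSgn_eq_card {V : Type*} [Fintype V] {k : ℕ} (G : SimpleGraph V)
    (lab : V → Fin k) (s : ℕ) (σ : Fin k → Fin 3) :
    countSgn G lab s σ =
      (Finset.univ.filter fun S : Set V => S.ncard = s ∧ SgnIs G lab S σ).card := by
  rw [countSgn, ← Set.ncard_coe_finset]
  simp

/-- Counting partial matchings by size and signature through a join operation `η_{i,j}`. -/
theorem count_sgn_join {V : Type*} [Fintype V] {k : ℕ} (H' H : SimpleGraph V)
    (lab : V → Fin k) (i j : Fin k) (hij : i ≠ j)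
    (hirred : ∀ u v : V, lab u = i → lab v = j → ¬ H'.Adj u v)
    (hH : ∀ u v : V, H.Adj u v ↔ H'.Adj u v ∨
      (u ≠ v ∧ ((lab u = i ∧ lab v = j) ∨ (lab u = j ∧ lab v = i)))) :
    ∀ (s : ℕ) (σ : Fin k → Fin 3),
      countSgn H lab s σ =
        ∑ σ' : Fin k → Fin 3, if fRel i j σ' σ then countSgn H' lab s σ' else 0 := by
  intro s σ
  simp only [countSgn_eq_card]
  rw [← Finset.sum_filter, ← Finset.card_biUnion]
  · congr 1
    ext S
    simp only [Finset.mem_filter, Finset.mem_univ, true_and, Finset.mem_biUnion,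
      SgnIs_join_iff hij hirred hH]
    tauto
  · intro σ₁ _ σ₂ _ hne
    rw [Function.onFun, Finset.disjoint_left]
    intro S h₁ h₂
    exact hne (SgnIs_unique (Finset.mem_filter.1 h₁).2.2 (Finset.mem_filter.1 h₂).2.2)
end

section
/- Let H' be a k-labeled graph, let i ≠ j be labels, and let H = ρ_{i→j}(H') be the k-labeled graph with the same underlying graph as H' in which every vertex of label i is relabeled to label j. Then for every natural number s and every tuple σ ∈ {0,1,2}^k, the number of sets S ⊆ V(H) with |S| = s and sgn_H(S) defined and equal to σ is equal to the sum, over all σ' ∈ {0,1,2}^k with g_{i→j}(σ') defined and equal to σ, of the number of sets S' ⊆ V(H') with |S'| = s and sgn_{H'}(S') defined and equal to σ'. Here g_{i→j} is the partial function on {0,1,2}^k with g_{i→j}(σ') = σ given by: σ(w) = σ'(w) for all w ∉ {i,j}; σ(i) = 0; σ(j) = max{σ'(i), σ'(j)} if 0 ∈ {σ'(i), σ'(j)}; σ(j) = 1 if σ'(i) = σ'(j) = 1; and g_{i→j}(σ') is undefined otherwise. -/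
open scoped Classical

/-- The partial function `g_{i→j}` is defined at `σ'` with value `σ`. -/
def gRel {k : ℕ} (i j : Fin k) (σ' σ : Fin k → Fin 3) : Prop :=
  (∀ w : Fin k, w ≠ i → w ≠ j → σ w = σ' w) ∧ σ i = 0 ∧
  (((σ' i = 0 ∨ σ' j = 0) ∧ σ j = max (σ' i) (σ' j)) ∨
   ((σ' i = 1 ∧ σ' j = 1) ∧ σ j = 1))

/-- The signature at a label depends only on the degrees and on the label class `A` of `S`:
the class `A` has signature `a` with respect to the degree function `d`. -/
def ClassSgn {V : Type*} (d : V → ℕ) (A : Set V) (a : Fin 3) : Prop :=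
  (a = 0 ∧ A = ∅) ∨ (a = 1 ∧ A.Nonempty ∧ ∀ v ∈ A, d v = 1) ∨
    (a = 2 ∧ ∃ v : V, A = {v} ∧ d v = 0)

theorem sgnAtIs_iff_classSgn {V : Type*} {k : ℕ} (G : SimpleGraph V) (lab : V → Fin k)
    (S : Set V) (i : Fin k) (a : Fin 3) :
    sgnAtIs G lab S i a ↔ ClassSgn (degIn G S) (S ∩ {v | lab v = i}) a :=
  Iff.rfl

theorem classSgn_empty_iff {V : Type*} {d : V → ℕ} {a : Fin 3} :
    ClassSgn d ∅ a ↔ a = 0 := by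
  simp [ClassSgn, eq_comm (a := (∅ : Set V))]

theorem ClassSgn.unique {V : Type*} {d : V → ℕ} {A : Set V} {a b : Fin 3}
    (ha : ClassSgn d A a) (hb : ClassSgn d A b) : a = b := by
  rcases ha with ⟨rfl, rfl⟩ | ⟨rfl, hA, h1⟩ | ⟨rfl, v, rfl, h0⟩
  · exact (classSgn_empty_iff.1 hb).symm
  · rcases hb with ⟨rfl, rfl⟩ | ⟨rfl, -⟩ | ⟨rfl, v, rfl, h0⟩
    · simp at hA
    · rfl
    · simp [h0] at h1
  · rcases hb with ⟨rfl, h⟩ | ⟨rfl, -, h1⟩ | ⟨rfl, -⟩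
    · simp at h
    · simp [h0] at h1
    · rfl

/-- The signature of a disjoint union of two label classes. -/
theorem classSgn_union_iff {V : Type*} {d : V → ℕ} {A B : Set V} (hAB : Disjoint A B)
    {c : Fin 3} :
    ClassSgn d (A ∪ B) c ↔ ∃ a b, ClassSgn d A a ∧ ClassSgn d B b ∧
      (((a = 0 ∨ b = 0) ∧ c = max a b) ∨ ((a = 1 ∧ b = 1) ∧ c = 1)) := by
  rcases A.eq_empty_or_nonempty with rfl | hA
  · simp [classSgn_empty_iff]
  rcases B.eq_empty_or_nonempty with rfl | hB
  · simp [classSgn_empty_iff]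
  constructor
  · rintro (⟨-, h⟩ | ⟨rfl, -, h⟩ | ⟨-, v, h, -⟩)
    · exact absurd (Set.union_empty_iff.1 h).1 hA.ne_empty
    · exact ⟨1, 1, Or.inr (Or.inl ⟨rfl, hA, fun v hv => h v (Or.inl hv)⟩),
        Or.inr (Or.inl ⟨rfl, hB, fun v hv => h v (Or.inr hv)⟩), Or.inr ⟨⟨rfl, rfl⟩, rfl⟩⟩
    · obtain ⟨x, hx⟩ := hA
      obtain ⟨y, hy⟩ := hB
      have hxv : x ∈ ({v} : Set V) := h ▸ Or.inl hx
      have hyv : y ∈ ({v} : Set V) := h ▸ Or.inr hy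
      rw [Set.mem_singleton_iff] at hxv hyv
      exact absurd (hxv.trans hyv.symm) (Set.disjoint_iff_forall_ne.1 hAB hx hy)
  · rintro ⟨a, b, ha, hb, ⟨rfl | rfl, -⟩ | ⟨⟨rfl, rfl⟩, rfl⟩⟩
    · simp [ClassSgn, hA.ne_empty] at ha
    · simp [ClassSgn, hB.ne_empty] at hb
    · simp only [ClassSgn, one_ne_zero, false_and, true_and, false_or,
        show (1 : Fin 3) ≠ 2 by decide, or_false] at ha hb
      exact Or.inr (Or.inl ⟨rfl, hA.inl, fun v hv => hv.elim (ha.2 v) (hb.2 v)⟩)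

theorem SgnIs.unique {V : Type*} {k : ℕ} {G : SimpleGraph V} {lab : V → Fin k} {S : Set V}
    {σ τ : Fin k → Fin 3} (hσ : SgnIs G lab S σ) (hτ : SgnIs G lab S τ) : σ = τ :=
  funext fun i => ClassSgn.unique (hσ i) (hτ i)

/-- The signature after relabeling `i` to `j` is the image of the original one under
`g_{i→j}`. -/
theorem sgnIs_relabel_iff {V : Type*} {k : ℕ} {G : SimpleGraph V} {lab : V → Fin k}
    {i j : Fin k} (hij : i ≠ j) {S : Set V} {σ : Fin k → Fin 3} :
    SgnIs G (fun v => if lab v = i then j else lab v) S σ ↔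
      ∃ σ', gRel i j σ' σ ∧ SgnIs G lab S σ' := by
  have class_i : S ∩ {v | (if lab v = i then j else lab v) = i} = ∅ := by
    ext v
    by_cases h : lab v = i <;> simp [h, hij.symm]
  have class_j : S ∩ {v | (if lab v = i then j else lab v) = j} =
      (S ∩ {v | lab v = i}) ∪ (S ∩ {v | lab v = j}) := by
    ext v
    by_cases h : lab v = i <;> simp [h, hij]
  have class_other : ∀ w, w ≠ i → w ≠ j →
      S ∩ {v | (if lab v = i then j else lab v) = w} = S ∩ {v | lab v = w} := by
    intro w hi hj
    ext v
    by_cases h : lab v = i <;> simp [h, hi.symm, hj.symm]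
  have disj : Disjoint (S ∩ {v | lab v = i}) (S ∩ {v | lab v = j}) :=
    Set.disjoint_left.2 fun v hv hv' => hij (hv.2.symm.trans hv'.2)
  simp only [SgnIs, sgnAtIs_iff_classSgn]
  constructor
  · intro h
    have hi := h i
    have hj := h j
    rw [class_i, classSgn_empty_iff] at hi
    rw [class_j, classSgn_union_iff disj] at hj
    obtain ⟨a, b, ha, hb, hab⟩ := hj
    refine ⟨fun w => if w = i then a else if w = j then b else σ w, ⟨?_, hi, ?_⟩, ?_⟩
    · intro w hwi hwj
      simp [hwi, hwj]
    · simpa [hij.symm] using hab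
    · intro w
      by_cases hwi : w = i
      · subst hwi
        simpa using ha
      by_cases hwj : w = j
      · subst hwj
        simpa [hwi] using hb
      · simpa [hwi, hwj, class_other w hwi hwj] using h w
  · rintro ⟨σ', ⟨hother, hi, hj⟩, h⟩ w
    by_cases hwi : w = i
    · subst hwi
      rw [class_i, classSgn_empty_iff]
      exact hi
    by_cases hwj : w = j
    · subst hwj
      rw [class_j, classSgn_union_iff disj]
      exact ⟨σ' i, σ' w, h i, h w, hj⟩
    · rw [class_other w hwi hwj, hother w hwi hwj]
      exact h w

/-- Counting partial matchings by size and signature through a relabel operation `ρ_{i→j}`. -/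
theorem count_sgn_relabel {V : Type*} [Fintype V] {k : ℕ} (G : SimpleGraph V)
    (lab : V → Fin k) (i j : Fin k) (hij : i ≠ j) :
    ∀ (s : ℕ) (σ : Fin k → Fin 3),
      countSgn G (fun v => if lab v = i then j else lab v) s σ =
        ∑ σ' : Fin k → Fin 3, if gRel i j σ' σ then countSgn G lab s σ' else 0 := by
  intro s σ
  have card_eq : ∀ (lab : V → Fin k) (σ : Fin k → Fin 3), countSgn G lab s σ =
      (Finset.univ.filter fun S : Set V => S.ncard = s ∧ SgnIs G lab S σ).card := by
    intro lab σ
    rw [countSgn, ← Set.ncard_coe_finset]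
    simp
  simp only [card_eq]
  rw [← Finset.sum_filter, ← Finset.card_biUnion]
  · congr 1
    ext S
    simp only [Finset.mem_filter, Finset.mem_univ, true_and, Finset.mem_biUnion,
      sgnIs_relabel_iff hij]
    tauto
  · intro τ _ τ' _ hne
    refine Finset.disjoint_left.2 fun S hS hS' => hne ?_
    exact (Finset.mem_filter.1 hS).2.2.unique (Finset.mem_filter.1 hS').2.2
end
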